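/- The improper integral ∫_0^∞ (e^{-it} - 1)/t^{3/2} dt converges and equals 2√π · e^{-3iπ/4}. -/

import Mathlib

open Complex MeasureTheory Filter

open Set Topology

lemma norm_exp_sub_one_le_two_of_re_nonpos {w : ℂ} (hw : w.re ≤ 0) :
    ‖Complex.exp w - 1‖ ≤ 2 := by
  have h : ‖Complex.exp w‖ ≤ 1 := by
    rw [Complex.norm_exp]
    exact Real.exp_le_one_iff.mpr hw
  calc ‖Complex.exp w - 1‖ ≤ ‖Complex.exp w‖ + ‖(1 : ℂ)‖ := norm_sub_le _ _
    _ ≤ 2 := by rw [norm_one]; linarith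

lemma norm_exp_sub_one_le_of_re_nonpos {w : ℂ} (hw : w.re ≤ 0) :
    ‖Complex.exp w - 1‖ ≤ 2 * ‖w‖ := by
  rcases le_total ‖w‖ 1 with h | h
  · exact Complex.norm_exp_sub_one_le h
  · linarith [norm_exp_sub_one_le_two_of_re_nonpos hw]

lemma neg_mul_sq_re_nonpos {z : ℂ} (hz : 0 ≤ z.re) (x : ℝ) : (-z * (x : ℂ) ^ 2).re ≤ 0 := by
  rw [← ofReal_pow, re_mul_ofReal, neg_re]
  nlinarith [mul_nonneg hz (sq_nonneg x)]

lemma norm_exp_neg_mul_sq_sub_one_div_sq_le {z : ℂ} (hz : 0 ≤ z.re) (hz2 : ‖z‖ ≤ 2)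
    {x : ℝ} (hx : 0 < x) :
    ‖(Complex.exp (-z * (x : ℂ) ^ 2) - 1) / (x : ℂ) ^ 2‖ ≤ 8 * (1 + x ^ 2)⁻¹ := by
  have h1 := norm_exp_sub_one_le_two_of_re_nonpos (neg_mul_sq_re_nonpos hz x)
  have h2 := norm_exp_sub_one_le_of_re_nonpos (neg_mul_sq_re_nonpos hz x)
  have hn : ‖(x : ℂ) ^ 2‖ = x ^ 2 := by
    rw [norm_pow, norm_real, Real.norm_eq_abs, sq_abs]
  rw [norm_mul, norm_neg, hn] at h2
  have hx2 : 0 < x ^ 2 := by positivity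
  rw [norm_div, hn, ← div_eq_mul_inv, div_le_div_iff₀ hx2 (by positivity)]
  nlinarith [mul_le_mul_of_nonneg_right hz2 hx2.le]

lemma aestronglyMeasurable_exp_neg_mul_sq_sub_one_div_sq (z : ℂ) (μ : Measure ℝ) :
    AEStronglyMeasurable
      (fun x : ℝ => (Complex.exp (-z * (x : ℂ) ^ 2) - 1) / (x : ℂ) ^ 2) μ := by
  apply Measurable.aestronglyMeasurable
  fun_prop

lemma integrableOn_exp_neg_mul_sq_sub_one_div_sq {z : ℂ} (hz : 0 ≤ z.re) (hz2 : ‖z‖ ≤ 2) :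
    IntegrableOn (fun x : ℝ => (Complex.exp (-z * (x : ℂ) ^ 2) - 1) / (x : ℂ) ^ 2) (Ioi 0) := by
  refine Integrable.mono' ((integrable_inv_one_add_sq.const_mul 8).integrableOn)
    (aestronglyMeasurable_exp_neg_mul_sq_sub_one_div_sq z _) ?_
  filter_upwards [ae_restrict_mem measurableSet_Ioi] with x hx
  exact norm_exp_neg_mul_sq_sub_one_div_sq_le hz hz2 hx

lemma integral_exp_neg_mul_sq_sub_one_div_sq_of_re_pos {z : ℂ} (hz : 0 < z.re) (hz2 : ‖z‖ ≤ 2) :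
    ∫ x in Ioi (0 : ℝ), (Complex.exp (-z * (x : ℂ) ^ 2) - 1) / (x : ℂ) ^ 2 =
      -z * (Real.pi / z) ^ (1 / 2 : ℂ) := by
  have hi := integrableOn_exp_neg_mul_sq_sub_one_div_sq hz.le hz2
  have hg : IntegrableOn (fun x : ℝ => 2 * z * Complex.exp (-z * (x : ℂ) ^ 2)) (Ioi 0) :=
    ((integrable_cexp_neg_mul_sq hz).const_mul _).integrableOn
  have hbound (x : ℝ) : ‖-(Complex.exp (-z * (x : ℂ) ^ 2) - 1) / (x : ℂ)‖ ≤ 2 * ‖z‖ * |x| := by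
    rcases eq_or_ne x 0 with rfl | hx
    · simp
    have h2 := norm_exp_sub_one_le_of_re_nonpos (neg_mul_sq_re_nonpos hz.le x)
    rw [norm_div, norm_neg, norm_real, Real.norm_eq_abs, div_le_iff₀ (abs_pos.mpr hx)]
    rw [norm_mul, norm_neg, norm_pow, norm_real, Real.norm_eq_abs] at h2
    linarith
  have key : ∫ x in Ioi (0 : ℝ), ((Complex.exp (-z * (x : ℂ) ^ 2) - 1) / (x : ℂ) ^ 2 +
      2 * z * Complex.exp (-z * (x : ℂ) ^ 2)) =
      0 - -(Complex.exp (-z * ((0 : ℝ) : ℂ) ^ 2) - 1) / ((0 : ℝ) : ℂ) := by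
    refine integral_Ioi_of_hasDerivAt_of_tendsto
      (f := fun x : ℝ => -(Complex.exp (-z * (x : ℂ) ^ 2) - 1) / (x : ℂ)) ?_ ?_ (hi.add hg) ?_
    · apply ContinuousAt.continuousWithinAt
      have h0 : Tendsto (fun x : ℝ => 2 * ‖z‖ * |x|) (𝓝 0) (𝓝 0) := by
        have : Continuous fun x : ℝ => 2 * ‖z‖ * |x| := by fun_prop
        simpa using this.tendsto 0
      simpa [ContinuousAt] using squeeze_zero_norm hbound h0
    · intro x hx
      have hx0 : (x : ℂ) ≠ 0 := ofReal_ne_zero.mpr (ne_of_gt hx)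
      have hd : HasDerivAt (fun w : ℂ => -(Complex.exp (-z * w ^ 2) - 1) / w)
          ((Complex.exp (-z * (x : ℂ) ^ 2) - 1) / (x : ℂ) ^ 2 +
            2 * z * Complex.exp (-z * (x : ℂ) ^ 2)) (x : ℂ) := by
        have h1 := ((((hasDerivAt_pow 2 (x : ℂ)).const_mul (-z)).cexp.sub_const 1).neg).div
          (hasDerivAt_id (x : ℂ)) hx0
        refine HasDerivAt.congr_deriv h1 ?_
        simp only [id, Pi.neg_apply]
        field_simp
        push_cast
        ring
      exact hd.comp_ofReal
    · refine squeeze_zero_norm' (a := fun x : ℝ => 2 / x) ?_ (tendsto_const_nhds.div_atTop tendsto_id)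
      filter_upwards [eventually_gt_atTop 0] with x hx
      have h1 := norm_exp_sub_one_le_two_of_re_nonpos (neg_mul_sq_re_nonpos hz.le x)
      rw [norm_div, norm_neg, norm_real, Real.norm_eq_abs, abs_of_pos hx]
      gcongr
  rw [integral_add hi hg, integral_const_mul, integral_gaussian_complex_Ioi hz] at key
  simp only [ofReal_zero, div_zero, sub_zero] at key
  linear_combination key

lemma integral_exp_neg_I_mul_sq_sub_one_div_sq :
    ∫ x in Ioi (0 : ℝ), (Complex.exp (-I * (x : ℂ) ^ 2) - 1) / (x : ℂ) ^ 2 =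
      -I * (Real.pi / I) ^ (1 / 2 : ℂ) := by
  have hz : Tendsto (fun b : ℝ => (b : ℂ) + I) (𝓝[>] 0) (𝓝 I) := by
    have : Continuous fun b : ℝ => (b : ℂ) + I := by fun_prop
    simpa using (this.tendsto 0).mono_left nhdsWithin_le_nhds
  have hev : ∀ᶠ b : ℝ in 𝓝[>] 0, 0 < ((b : ℂ) + I).re ∧ ‖(b : ℂ) + I‖ ≤ 2 := by
    have h2 : ∀ᶠ b : ℝ in 𝓝[>] 0, ‖(b : ℂ) + I‖ < 2 :=
      hz.norm.eventually_lt_const (by simp)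
    filter_upwards [h2, self_mem_nhdsWithin] with b hb hb0
    exact ⟨by simpa using hb0, hb.le⟩
  have h1 : Tendsto (fun b : ℝ => ∫ x in Ioi (0 : ℝ),
      (Complex.exp (-((b : ℂ) + I) * (x : ℂ) ^ 2) - 1) / (x : ℂ) ^ 2) (𝓝[>] 0)
      (𝓝 (∫ x in Ioi (0 : ℝ), (Complex.exp (-I * (x : ℂ) ^ 2) - 1) / (x : ℂ) ^ 2)) := by
    refine tendsto_integral_filter_of_dominated_convergence (fun x : ℝ => 8 * (1 + x ^ 2)⁻¹)
      (Eventually.of_forall fun b => aestronglyMeasurable_exp_neg_mul_sq_sub_one_div_sq _ _)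
      ?_ (integrable_inv_one_add_sq.const_mul 8).integrableOn ?_
    · filter_upwards [hev] with b hb
      filter_upwards [ae_restrict_mem measurableSet_Ioi] with x hx
      exact norm_exp_neg_mul_sq_sub_one_div_sq_le hb.1.le hb.2 hx
    · refine Eventually.of_forall fun x => ?_
      have : Continuous fun z : ℂ => (Complex.exp (-z * (x : ℂ) ^ 2) - 1) / (x : ℂ) ^ 2 := by
        fun_prop
      exact (this.tendsto I).comp hz
  have h2 : Tendsto (fun b : ℝ => -((b : ℂ) + I) * (Real.pi / ((b : ℂ) + I)) ^ (1 / 2 : ℂ))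
      (𝓝[>] 0) (𝓝 (-I * (Real.pi / I) ^ (1 / 2 : ℂ))) := by
    refine hz.neg.mul ((tendsto_const_nhds.div hz I_ne_zero).cpow tendsto_const_nhds ?_)
    right
    simp [Real.pi_ne_zero]
  refine tendsto_nhds_unique (h1.congr' ?_) h2
  filter_upwards [hev] with b hb
  exact integral_exp_neg_mul_sq_sub_one_div_sq_of_re_pos hb.1 hb.2

lemma neg_I_mul_pi_div_I_cpow_half :
    -I * (Real.pi / I) ^ (1 / 2 : ℂ) =
      Real.sqrt Real.pi * Complex.exp (-3 * Real.pi * Complex.I / 4) := by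
  have h1 : (Real.pi / I : ℂ) ^ (1 / 2 : ℂ) =
      Real.sqrt Real.pi * Complex.exp (-(Real.pi / 4) * I) := by
    have h0 : (Real.pi / I : ℂ) = Real.pi * -I := by rw [div_I, mul_neg]
    rw [h0, cpow_def_of_ne_zero
      (mul_ne_zero (ofReal_ne_zero.mpr Real.pi_ne_zero) (neg_ne_zero.mpr I_ne_zero)),
      log_ofReal_mul Real.pi_pos (neg_ne_zero.mpr I_ne_zero), log_neg_I, Real.sqrt_eq_rpow,
      Real.rpow_def_of_pos Real.pi_pos, ofReal_exp, ← Complex.exp_add]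
    congr 1
    push_cast
    ring
  have h2 : -I = Complex.exp (-(Real.pi / 2) * I) := by
    rw [neg_mul, Complex.exp_neg, Complex.exp_pi_div_two_mul_I, inv_I]
  rw [h1, h2, mul_left_comm, ← Complex.exp_add]
  congr 2
  ring

lemma rpow_smul_comp_rpow_two {x : ℝ} (hx : 0 < x) :
    (2 * x ^ ((2 : ℝ) - 1)) • ((Complex.exp (-((x ^ (2 : ℝ) : ℝ) : ℂ) * I) - 1) /
        (((x ^ (2 : ℝ)) ^ ((3 : ℝ) / 2) : ℝ) : ℂ)) =
      2 * ((Complex.exp (-I * (x : ℂ) ^ 2) - 1) / (x : ℂ) ^ 2) := by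
  have h3 : (x ^ (2 : ℝ)) ^ ((3 : ℝ) / 2) = x ^ 3 := by
    rw [← Real.rpow_mul hx.le, ← Real.rpow_natCast]
    norm_num
  have h1 : x ^ ((2 : ℝ) - 1) = x := by norm_num
  have hx0 : (x : ℂ) ≠ 0 := ofReal_ne_zero.mpr hx.ne'
  rw [h3, h1, Real.rpow_two, real_smul]
  push_cast
  rw [show -(x : ℂ) ^ 2 * I = -I * (x : ℂ) ^ 2 by ring]
  field_simp

/-- The improper integral ∫_0^∞ (e^{-it} - 1)/t^{3/2} dt converges to 2√π e^{-3iπ/4}. -/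
theorem stmt_2 :
    Tendsto (fun X : ℝ =>
        ∫ t in (0:ℝ)..X, (Complex.exp (-(t : ℂ) * Complex.I) - 1) / ((t ^ ((3:ℝ)/2) : ℝ) : ℂ))
      atTop
      (nhds (2 * Real.sqrt Real.pi * Complex.exp (-3 * Real.pi * Complex.I / 4))) := by
  have hint : IntegrableOn (fun t : ℝ =>
      (Complex.exp (-(t : ℂ) * Complex.I) - 1) / ((t ^ ((3:ℝ)/2) : ℝ) : ℂ)) (Ioi 0) := by
    rw [← integrableOn_Ioi_comp_rpow_iff _ (two_ne_zero : (2 : ℝ) ≠ 0)]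
    refine IntegrableOn.congr_fun (((integrableOn_exp_neg_mul_sq_sub_one_div_sq (z := I)
      (by simp) (by simp)).const_mul 2)) (fun x hx => ?_) measurableSet_Ioi
    rw [abs_two]
    exact (rpow_smul_comp_rpow_two hx).symm
  have hval : ∫ t in Ioi (0 : ℝ),
      (Complex.exp (-(t : ℂ) * Complex.I) - 1) / ((t ^ ((3:ℝ)/2) : ℝ) : ℂ) =
      2 * Real.sqrt Real.pi * Complex.exp (-3 * Real.pi * Complex.I / 4) := by
    rw [← integral_comp_rpow_Ioi_of_pos (two_pos : (0 : ℝ) < 2),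
      setIntegral_congr_fun measurableSet_Ioi fun x hx => rpow_smul_comp_rpow_two hx,
      integral_const_mul, integral_exp_neg_I_mul_sq_sub_one_div_sq,
      neg_I_mul_pi_div_I_cpow_half, ← mul_assoc]
  rw [← hval]
  exact intervalIntegral_tendsto_integral_Ioi 0 hint tendsto_id
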